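/- arXiv:1404.6585 — 3 statements merged into one kernel-verified Lean document; each statement's English description precedes it below -/
import Mathlib

section
/- Fix δ ∈ (0,1), n ≥ 1, and a nonempty set A ⊆ 𝒳ⁿ, and let {B_k}_{k=0}^{K_δ} be the δ-information-spectrum partition of 𝒴ⁿ w.r.t. the information spectrum of P_A. For any k′ ∈ [0, K_δ], let B′ = ⋃_{k=0}^{k′} B_k and η_{k′} = P_A(B′). Then every set B̂ ⊆ 𝒴ⁿ with B̂ ≠ B′ and |B̂| ≤ |B′| satisfies P_A(B̂) < η_{k′}. Consequently, B′ is the unique minimum-cardinality η_{k′}-quasi-image of A, i.e. |B′| = ḡⁿ(A, η_{k′}) and no other set of cardinality at most |B′| is an η_{k′}-quasi-image of A. -/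
open scoped BigOperators Classical
open Finset Real

noncomputable section

/-- The `n`-fold product channel: `Wⁿ(yⁿ|xⁿ) = ∏ⱼ W(yⱼ|xⱼ)`. -/
def prodW {X Y : Type*} (W : X → Y → ℝ) {n : ℕ} (x : Fin n → X) (y : Fin n → Y) : ℝ :=
  ∏ j, W (x j) (y j)

/-- Probability `Wⁿ(B|xⁿ)` of an output set `B` given input `xⁿ`. -/
def prodWSet {X Y : Type*} (W : X → Y → ℝ) {n : ℕ} (x : Fin n → X)
    (B : Finset (Fin n → Y)) : ℝ :=
  ∑ y ∈ B, prodW W x y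

/-- Output distribution `P_A` of `Wⁿ` with uniformly distributed input on `A`. -/
def outDist {X Y : Type*} (W : X → Y → ℝ) {n : ℕ}
    (A : Finset (Fin n → X)) (y : Fin n → Y) : ℝ :=
  (A.card : ℝ)⁻¹ * ∑ x ∈ A, prodW W x y

/-- `W` is a channel: each row is a probability distribution on `Y`. -/
def isChannel {X Y : Type*} [Fintype Y] (W : X → Y → ℝ) : Prop :=
  ∀ x, (∀ y, 0 ≤ W x y) ∧ ∑ y, W x y = 1

/-- `K_δ = ⌈(log₂ |𝒴|)/δ⌉`. -/
def Kdel (c : ℕ) (δ : ℝ) : ℕ := ⌈Real.logb 2 c / δ⌉₊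

/-- The sets `B_k` of the `δ`-information-spectrum partition of `𝒴ⁿ` w.r.t. the
information spectrum `i_n(yⁿ) = -(1/n) log₂ p(yⁿ)`:  membership `kδ ≤ i_n(yⁿ) < (k+1)δ`
(resp. `Kδ ≤ i_n(yⁿ) < ∞` for `k = K`) is expressed directly in terms of `p`. -/
def specSet {Y : Type*} [Fintype Y] {n : ℕ} (p : (Fin n → Y) → ℝ)
    (δ : ℝ) (K k : ℕ) : Finset (Fin n → Y) :=
  if k < K then
    Finset.univ.filter fun y =>
      (2:ℝ) ^ (-((n:ℝ) * ((k:ℝ)+1) * δ)) < p y ∧ p y ≤ (2:ℝ) ^ (-((n:ℝ) * (k:ℝ) * δ))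
  else
    Finset.univ.filter fun y => 0 < p y ∧ p y ≤ (2:ℝ) ^ (-((n:ℝ) * (K:ℝ) * δ))

/-- `ḡⁿ(A,η)`: minimum cardinality of an `η`-quasi-image of `A` over `Wⁿ`. -/
def gbar {X Y : Type*} [Fintype Y] (W : X → Y → ℝ) {n : ℕ}
    (A : Finset (Fin n → X)) (η : ℝ) : ℕ :=
  sInf {m | ∃ B : Finset (Fin n → Y), B.card = m ∧ η ≤ ∑ y ∈ B, outDist W A y}

/-- `gⁿ(A,η)`: minimum cardinality of an `η`-image of `A` over `Wⁿ`. -/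
def gimg {X Y : Type*} [Fintype Y] (W : X → Y → ℝ) {n : ℕ}
    (A : Finset (Fin n → X)) (η : ℝ) : ℕ :=
  sInf {m | ∃ B : Finset (Fin n → Y), B.card = m ∧ ∀ x ∈ A, η ≤ prodWSet W x B}

/-- Shannon entropy (base 2) of a distribution `q` on a finite set. -/
def ent {Z : Type*} [Fintype Z] (q : Z → ℝ) : ℝ :=
  -∑ z, q z * Real.logb 2 (q z)

end

/-- Union `⋃_{l=0}^{k} B_l` of the first `k+1` sets of the partition. -/
noncomputable def cumSpec {Y : Type*} [Fintype Y] {n : ℕ} (p : (Fin n → Y) → ℝ)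
    (δ : ℝ) (K k : ℕ) : Finset (Fin n → Y) :=
  (Finset.range (k + 1)).biUnion fun l => specSet p δ K l

theorem prodW_le_one {X Y : Type*} [Fintype Y] {W : X → Y → ℝ} (hW : isChannel W) {n : ℕ}
    (x : Fin n → X) (y : Fin n → Y) : prodW W x y ≤ 1 := by
  refine Finset.prod_le_one (fun j _ => (hW (x j)).1 (y j)) fun j _ => ?_
  rw [← (hW (x j)).2]
  exact Finset.single_le_sum (fun z _ => (hW (x j)).1 z) (Finset.mem_univ (y j))

theorem outDist_le_one {X Y : Type*} [Fintype Y] {W : X → Y → ℝ} (hW : isChannel W) {n : ℕ}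
    (A : Finset (Fin n → X)) (y : Fin n → Y) : outDist W A y ≤ 1 := by
  have hsum : ∑ x ∈ A, prodW W x y ≤ A.card := by
    simpa using Finset.sum_le_card_nsmul A _ 1 fun x _ => prodW_le_one hW x y
  calc outDist W A y ≤ (A.card : ℝ)⁻¹ * A.card :=
        mul_le_mul_of_nonneg_left hsum (by positivity)
    _ ≤ 1 := inv_mul_le_one

theorem cumSpec_succ {Y : Type*} [Fintype Y] {n : ℕ} (p : (Fin n → Y) → ℝ) (δ : ℝ) (K k : ℕ) :
    cumSpec p δ K (k + 1) = specSet p δ K (k + 1) ∪ cumSpec p δ K k := by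
  rw [cumSpec, Finset.range_add_one, Finset.biUnion_insert, cumSpec]

theorem mem_cumSpec_of_lt {Y : Type*} [Fintype Y] {n : ℕ} {p : (Fin n → Y) → ℝ}
    (hp : ∀ y, p y ≤ 1) {δ : ℝ} (hδ : 0 ≤ δ) {K k : ℕ} (hk : k < K) (y : Fin n → Y) :
    y ∈ cumSpec p δ K k ↔ (2 : ℝ) ^ (-((n : ℝ) * ((k : ℝ) + 1) * δ)) < p y := by
  induction k with
  | zero => simp [cumSpec, specSet, hk, hp y]
  | succ k ih =>
    rw [cumSpec_succ, Finset.mem_union, ih (by omega), specSet, if_pos hk, Finset.mem_filter]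
    push_cast
    have hmono : (2 : ℝ) ^ (-((n : ℝ) * ((k : ℝ) + 1 + 1) * δ)) ≤
        (2 : ℝ) ^ (-((n : ℝ) * ((k : ℝ) + 1) * δ)) := by
      apply Real.rpow_le_rpow_of_exponent_le one_le_two
      have : 0 ≤ (n : ℝ) * δ := by positivity
      linarith
    constructor
    · rintro (h | h)
      · exact h.2.1
      · exact hmono.trans_lt h
    · intro h
      by_cases h' : p y ≤ (2 : ℝ) ^ (-((n : ℝ) * ((k : ℝ) + 1) * δ))
      · exact Or.inl ⟨Finset.mem_univ _, h, h'⟩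
      · exact Or.inr (not_le.mp h')

theorem mem_cumSpec_self {Y : Type*} [Fintype Y] {n : ℕ} {p : (Fin n → Y) → ℝ}
    (hp : ∀ y, p y ≤ 1) {δ : ℝ} (hδ : 0 ≤ δ) (K : ℕ) (y : Fin n → Y) :
    y ∈ cumSpec p δ K K ↔ 0 < p y := by
  cases K with
  | zero => simp [cumSpec, specSet, hp y]
  | succ k =>
    rw [cumSpec_succ, Finset.mem_union, mem_cumSpec_of_lt hp hδ (Nat.lt_succ_self k), specSet,
      if_neg (lt_irrefl _), Finset.mem_filter]
    push_cast
    constructor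
    · rintro (h | h)
      · exact h.2.1
      · exact (Real.rpow_pos_of_pos two_pos _).trans h
    · intro h
      by_cases h' : p y ≤ (2 : ℝ) ^ (-((n : ℝ) * ((k : ℝ) + 1) * δ))
      · exact Or.inl ⟨Finset.mem_univ _, h, h'⟩
      · exact Or.inr (not_le.mp h')

theorem exists_threshold_cumSpec {Y : Type*} [Fintype Y] {n : ℕ} {p : (Fin n → Y) → ℝ}
    (hp : ∀ y, p y ≤ 1) {δ : ℝ} (hδ : 0 ≤ δ) {K k : ℕ} (hk : k ≤ K) :
    ∃ t : ℝ, 0 ≤ t ∧ ∀ y, y ∈ cumSpec p δ K k ↔ t < p y := by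
  rcases hk.lt_or_eq with hlt | rfl
  · exact ⟨_, (Real.rpow_pos_of_pos two_pos _).le, mem_cumSpec_of_lt hp hδ hlt⟩
  · exact ⟨0, le_rfl, mem_cumSpec_self hp hδ k⟩

/-- A strict superlevel set of `p` at a nonnegative level has strictly larger `p`-sum than any
other set of at most the same cardinality. -/
theorem sum_lt_sum_of_superlevel {Z : Type*} {p : Z → ℝ} {t : ℝ} (ht : 0 ≤ t) {B C : Finset Z}
    (hB : ∀ z, z ∈ B ↔ t < p z) (hne : C ≠ B) (hcard : C.card ≤ B.card) :
    ∑ z ∈ C, p z < ∑ z ∈ B, p z := by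
  have hnonempty : (B \ C).Nonempty := by
    rw [Finset.sdiff_nonempty]
    exact fun hsub => hne (Finset.eq_of_subset_of_card_le hsub hcard).symm
  have hcard' : ((C \ B).card : ℝ) ≤ (B \ C).card := by
    exact_mod_cast (Finset.card_sdiff_le_card_sdiff_iff).2 hcard
  rw [← Finset.sum_sdiff_lt_sum_sdiff]
  calc ∑ z ∈ C \ B, p z ≤ ∑ _z ∈ C \ B, t :=
        Finset.sum_le_sum fun z hz =>
          not_lt.mp fun h => (Finset.mem_sdiff.mp hz).2 ((hB z).2 h)
    _ = (C \ B).card * t := by simp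
    _ ≤ (B \ C).card * t := mul_le_mul_of_nonneg_right hcard' ht
    _ = ∑ _z ∈ B \ C, t := by simp
    _ < ∑ z ∈ B \ C, p z :=
        Finset.sum_lt_sum_of_nonempty hnonempty fun z hz => (hB z).1 (Finset.mem_sdiff.mp hz).1

/-- `B' = ⋃_{k=0}^{k'} B_k` is the unique minimum-cardinality
`η_{k'}`-quasi-image of `A`. -/
theorem stmt_2 {X Y : Type*} [Fintype X] [Fintype Y] [Nonempty X] [Nonempty Y]
    (W : X → Y → ℝ) (hW : isChannel W)
    (δ : ℝ) (hδ : δ ∈ Set.Ioo (0:ℝ) 1)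
    (n : ℕ) (hn : 1 ≤ n)
    (A : Finset (Fin n → X)) (hA : A.Nonempty)
    (K : ℕ) (hK : K = Kdel (Fintype.card Y) δ)
    (k' : ℕ) (hk' : k' ≤ K)
    (B' : Finset (Fin n → Y)) (hB' : B' = cumSpec (outDist W A) δ K k')
    (ηk : ℝ) (hηk : ηk = ∑ y ∈ B', outDist W A y) :
    (∀ Bhat : Finset (Fin n → Y), Bhat ≠ B' → Bhat.card ≤ B'.card →
      ∑ y ∈ Bhat, outDist W A y < ηk) ∧
    B'.card = gbar W A ηk := by
  subst hηk hB'
  obtain ⟨t, ht, hmem⟩ := exists_threshold_cumSpec (outDist_le_one hW A) hδ.1.le hk'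
  have hlt : ∀ Bhat : Finset (Fin n → Y), Bhat ≠ cumSpec (outDist W A) δ K k' →
      Bhat.card ≤ (cumSpec (outDist W A) δ K k').card →
      ∑ y ∈ Bhat, outDist W A y < ∑ y ∈ cumSpec (outDist W A) δ K k', outDist W A y :=
    fun _ hne hcard => sum_lt_sum_of_superlevel ht hmem hne hcard
  refine ⟨hlt, le_antisymm (le_csInf ⟨_, _, rfl, le_rfl⟩ ?_) (Nat.sInf_le ⟨_, rfl, le_rfl⟩)⟩
  rintro _ ⟨B, rfl, hB⟩
  by_contra! hcard
  exact (hlt B (fun h => hcard.ne (congrArg Finset.card h)) hcard.le).not_ge hB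
end

section
/- Fix the channel W and α′ ∈ (0,1). There exist sequences β_n ∈ (0,1) with β_n → 1 and τ_n ≥ 0 with τ_n → 0 such that for all sufficiently large n, every α ∈ [1/n², α′], and every nonempty A′ ⊆ 𝒳ⁿ: 0 ≤ (1/n)·log₂ gⁿ(A′, β_n) − (1/n)·log₂ gⁿ(A′, α) ≤ τ_n. That is, the same β_n and τ_n work uniformly over all values α ≥ 1/n². -/
open scoped BigOperators Classical
open Finset Real

/-- Two-point inequality behind the concentration bound: if `a` and `e` are reciprocal on the
diagonal and off by at most a factor `s` elsewhere, then the product of their means is bounded. -/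
theorem mean_mul_mean_le {Y : Type*} [Fintype Y] [Nonempty Y] (p a e : Y → ℝ) (K s C : ℝ)
    (hp : ∀ y, 0 ≤ p y) (hp1 : ∑ y, p y = 1) (ha : ∀ y, 0 ≤ a y)
    (hK : 0 < K) (hs : 1 ≤ s) (hC : (1 + s) ^ 2 ≤ 4 * s * C)
    (hdiag : ∀ y, e y * a y ≤ K) (hoff : ∀ y z, e y * a z ≤ s * K) :
    (∑ y, p y * e y) * (∑ y, p y * a y) ≤ K * C := by
  obtain ⟨y₀, -, hy₀⟩ := Finset.exists_max_image (Finset.univ : Finset Y) a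
    Finset.univ_nonempty
  set M := a y₀ with hM
  have hmax : ∀ y, a y ≤ M := fun y => hy₀ y (Finset.mem_univ y)
  have hC0 : 0 ≤ C := by
    have h1 : 0 ≤ 4 * s * C := le_trans (sq_nonneg _) hC
    by_contra h
    nlinarith
  have hm0 : 0 ≤ ∑ y, p y * a y := Finset.sum_nonneg fun y _ => mul_nonneg (hp y) (ha y)
  have hM0 : 0 ≤ M := ha y₀
  rcases hM0.eq_or_lt with h0 | hpos
  · have : ∀ y, a y = 0 := fun y => le_antisymm (h0 ▸ hmax y) (ha y)
    simp only [this, mul_zero, Finset.sum_const_zero]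
    positivity
  have key : ∀ y, M ^ 2 * e y ≤ K * ((1 + s) * M - s * a y) := by
    intro y
    by_cases h : M ≤ s * a y
    · have hay : 0 < a y := by
        by_contra hn
        have : a y = 0 := le_antisymm (not_lt.mp hn) (ha y)
        rw [this] at h
        linarith
      have h1 : M ^ 2 * (e y * a y) ≤ M ^ 2 * K :=
        mul_le_mul_of_nonneg_left (hdiag y) (sq_nonneg _)
      have h2 : 0 ≤ K * ((s * a y - M) * (M - a y)) :=
        mul_nonneg hK.le (mul_nonneg (by linarith) (by linarith [hmax y]))
      refine le_of_mul_le_mul_right ?_ hay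
      nlinarith
    · push Not at h
      have h1 : M * (e y * M) ≤ M * (s * K) := mul_le_mul_of_nonneg_left (hoff y y₀) hM0
      nlinarith [mul_pos hK (sub_pos.mpr h)]
  set m := ∑ y, p y * a y with hm
  have hsum : M ^ 2 * ∑ y, p y * e y ≤ K * ((1 + s) * M - s * m) := by
    calc M ^ 2 * ∑ y, p y * e y = ∑ y, p y * (M ^ 2 * e y) := by
          rw [Finset.mul_sum]
          exact Finset.sum_congr rfl fun y _ => by ring
      _ ≤ ∑ y, p y * (K * ((1 + s) * M - s * a y)) :=
          Finset.sum_le_sum fun y _ => mul_le_mul_of_nonneg_left (key y) (hp y)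
      _ = ∑ y, (p y * (K * ((1 + s) * M)) - K * s * (p y * a y)) :=
          Finset.sum_congr rfl fun y _ => by ring
      _ = K * ((1 + s) * M - s * m) := by
          rw [Finset.sum_sub_distrib, ← Finset.sum_mul, ← Finset.mul_sum, hp1]
          ring
  have hquad : (1 + s) * M * m - s * m ^ 2 ≤ M ^ 2 * C := by
    have h1 : M ^ 2 * (1 + s) ^ 2 ≤ M ^ 2 * (4 * s * C) :=
      mul_le_mul_of_nonneg_left hC (sq_nonneg _)
    have hs0 : 0 < 4 * s := by linarith
    refine le_of_mul_le_mul_left ?_ hs0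
    nlinarith [sq_nonneg ((1 + s) * M - 2 * s * m)]
  refine le_of_mul_le_mul_left ?_ (pow_pos hpos 2)
  calc M ^ 2 * ((∑ y, p y * e y) * m) = (M ^ 2 * ∑ y, p y * e y) * m := by ring
    _ ≤ K * ((1 + s) * M - s * m) * m := mul_le_mul_of_nonneg_right hsum hm0
    _ = K * ((1 + s) * M * m - s * m ^ 2) := by ring
    _ ≤ K * (M ^ 2 * C) := mul_le_mul_of_nonneg_left hquad hK.le
    _ = M ^ 2 * (K * C) := by ring

theorem one_add_exp_sq_le (t : ℝ) :
    (1 + exp t) ^ 2 ≤ 4 * exp t * exp (t ^ 2 / 4) := by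
  have h1 : 1 + exp t = 2 * exp (t / 2) * cosh (t / 2) := by
    have h2 : exp t = exp (t / 2) * exp (t / 2) := by rw [← exp_add]; ring_nf
    have h3 : exp (t / 2) * exp (-(t / 2)) = 1 := by rw [← exp_add]; simp
    rw [cosh_eq, h2]
    linear_combination -h3
  have h4 := cosh_le_exp_half_sq (t / 2)
  have h5 : cosh (t / 2) ^ 2 ≤ exp (t ^ 2 / 4) := by
    calc cosh (t / 2) ^ 2 ≤ exp ((t / 2) ^ 2 / 2) ^ 2 :=
          pow_le_pow_left₀ (cosh_pos _).le h4 2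
      _ = exp (t ^ 2 / 4) := by rw [← exp_nat_mul]; congr 1; push_cast; ring
  have h6 : exp (t / 2) ^ 2 = exp t := by rw [← exp_nat_mul]; congr 1; push_cast; ring
  rw [h1, mul_pow, mul_pow, h6]
  nlinarith [exp_pos t]

theorem sum_prod_fin_succ {Y : Type*} [Fintype Y] {n : ℕ} (p : Fin (n + 1) → Y → ℝ)
    (f : (Fin (n + 1) → Y) → ℝ) :
    ∑ y, (∏ j, p j (y j)) * f y =
      ∑ ω, p 0 ω * ∑ y : Fin n → Y, (∏ j, p j.succ (y j)) * f (Fin.cons ω y) := by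
  rw [← (Fin.consEquiv fun _ : Fin (n + 1) => Y).sum_comp, Fintype.sum_prod_type]
  refine Finset.sum_congr rfl fun ω _ => ?_
  rw [Finset.mul_sum]
  refine Finset.sum_congr rfl fun y _ => ?_
  simp [Fin.consEquiv, Fin.prod_univ_succ, mul_assoc]

theorem hammingDist_cons {Y : Type*} {n : ℕ} (ω ω' : Y) (y z : Fin n → Y) :
    hammingDist (Fin.cons ω y : Fin (n + 1) → Y) (Fin.cons ω' z) =
      (if ω = ω' then 0 else 1) + hammingDist y z := by
  simp only [hammingDist, Finset.card_filter, Fin.sum_univ_succ, Fin.cons_zero, Fin.cons_succ]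
  split_ifs <;> simp_all

/-- Functional form of concentration in Hamming distance for product distributions. -/
theorem product_mean_mul_mean_le {Y : Type*} [Fintype Y] [Nonempty Y] {t : ℝ} (ht : 0 ≤ t)
    (n : ℕ) (p : Fin n → Y → ℝ) (hp : ∀ j y, 0 ≤ p j y) (hp1 : ∀ j, ∑ y, p j y = 1)
    (f g : (Fin n → Y) → ℝ) (hf : ∀ y, 0 ≤ f y) (hg : ∀ y, 0 ≤ g y)
    (hfg : ∀ y z, f y * g z ≤ exp (t * hammingDist y z)) :
    (∑ y, (∏ j, p j (y j)) * f y) * (∑ y, (∏ j, p j (y j)) * g y) ≤ exp (t ^ 2 / 4) ^ n := by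
  induction n with
  | zero =>
    simpa using hfg default default
  | succ n ih =>
    have hw : ∀ y : Fin n → Y, 0 ≤ ∏ j, p (Fin.succ j) (y j) :=
      fun y => Finset.prod_nonneg fun j _ => hp _ _
    rw [sum_prod_fin_succ, sum_prod_fin_succ, pow_succ]
    refine mean_mul_mean_le (p 0) _ _ (exp (t ^ 2 / 4) ^ n) (exp t) _ (hp 0) (hp1 0)
      (fun ω => Finset.sum_nonneg fun y _ => mul_nonneg (hw y) (hg _))
      (by positivity) (one_le_exp ht) (one_add_exp_sq_le t) ?_ ?_
    · intro ω
      refine ih (fun j => p j.succ) (fun j => hp _) (fun j => hp1 _) _ _ (fun y => hf _)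
        (fun y => hg _) fun y z => ?_
      simpa [hammingDist_cons] using hfg (Fin.cons ω y) (Fin.cons ω z)
    · intro ω ω'
      have h := ih (fun j => p j.succ) (fun j => hp _) (fun j => hp1 _)
        (fun y => exp (-t) * f (Fin.cons ω y)) (fun z => g (Fin.cons ω' z))
        (fun y => mul_nonneg (exp_pos _).le (hf _)) (fun y => hg _) fun y z => by
          have h1 := hfg (Fin.cons ω y) (Fin.cons ω' z)
          have h2 : exp (t * hammingDist (Fin.cons ω y : Fin (n + 1) → Y) (Fin.cons ω' z)) ≤
              exp (t + t * hammingDist y z) := by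
            rw [hammingDist_cons, exp_le_exp]
            split_ifs <;> push_cast <;> nlinarith
          calc exp (-t) * f (Fin.cons ω y) * g (Fin.cons ω' z)
              = exp (-t) * (f (Fin.cons ω y) * g (Fin.cons ω' z)) := by ring
            _ ≤ exp (-t) * exp (t + t * hammingDist y z) :=
                mul_le_mul_of_nonneg_left (h1.trans h2) (exp_pos _).le
            _ = exp (t * hammingDist y z) := by rw [← exp_add]; ring_nf
      have h3 : ∑ y : Fin n → Y, (∏ j, p j.succ (y j)) * (exp (-t) * f (Fin.cons ω y)) =
          exp (-t) * ∑ y : Fin n → Y, (∏ j, p j.succ (y j)) * f (Fin.cons ω y) := by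
        rw [Finset.mul_sum]
        exact Finset.sum_congr rfl fun y _ => by ring
      rw [h3, mul_assoc, exp_neg, inv_mul_le_iff₀ (exp_pos t)] at h
      exact h

/-- The open Hamming neighbourhood of radius `ρ` of a set of words. -/
noncomputable def blowup {Y : Type*} [Fintype Y] {n : ℕ} (B : Finset (Fin n → Y)) (ρ : ℝ) :
    Finset (Fin n → Y) :=
  Finset.univ.filter fun y => ∃ z ∈ B, (hammingDist y z : ℝ) < ρ

theorem prodWSet_univ {X Y : Type*} [Fintype Y] {W : X → Y → ℝ} (hW : isChannel W) {n : ℕ}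
    (x : Fin n → X) : prodWSet W x Finset.univ = 1 := by
  have h := Finset.prod_univ_sum (fun _ : Fin n => (Finset.univ : Finset Y))
    (fun j y => W (x j) y)
  simp only [(hW _).2, Finset.prod_const_one, Fintype.piFinset_univ] at h
  exact h.symm

/-- Blowing-up lemma with explicit constants. -/
theorem prodWSet_mul_one_sub_blowup_le {X Y : Type*} [Fintype Y] [Nonempty Y]
    {W : X → Y → ℝ} (hW : isChannel W) {n : ℕ} (x : Fin n → X) (B : Finset (Fin n → Y))
    (ρ : ℝ) {t : ℝ} (ht : 0 ≤ t) :
    (1 - prodWSet W x (blowup B ρ)) * prodWSet W x B ≤ exp (n * t ^ 2 / 4 - t * ρ) := by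
  have hfg : ∀ y z : Fin n → Y, (if y ∈ blowup B ρ then 0 else exp (t * ρ)) *
      (if z ∈ B then 1 else 0) ≤ exp (t * hammingDist y z) := by
    intro y z
    split_ifs with h1 h2 h2
    · simpa using (exp_pos _).le
    · simpa using (exp_pos _).le
    · simp only [blowup, Finset.mem_filter, Finset.mem_univ, true_and, not_exists, not_and,
        not_lt] at h1
      rw [mul_one, exp_le_exp]
      exact mul_le_mul_of_nonneg_left (h1 z h2) ht
    · simpa using (exp_pos _).le
  have h := product_mean_mul_mean_le ht n (fun j => W (x j)) (fun j => (hW (x j)).1)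
    (fun j => (hW (x j)).2) _ _ (fun y => by split_ifs <;> positivity)
    (fun z => by split_ifs <;> norm_num) hfg
  have hB : ∑ z : Fin n → Y, (∏ j, W (x j) (z j)) * (if z ∈ B then (1 : ℝ) else 0) =
      prodWSet W x B := by
    simp [prodWSet, prodW]
  have hD : ∑ y : Fin n → Y,
      (∏ j, W (x j) (y j)) * (if y ∈ blowup B ρ then 0 else exp (t * ρ)) =
      (1 - prodWSet W x (blowup B ρ)) * exp (t * ρ) := by
    rw [← prodWSet_univ hW x, prodWSet, prodWSet,
      ← Finset.sum_compl_add_sum (blowup B ρ) (prodW W x), add_sub_cancel_right,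
      Finset.sum_mul, ← Finset.sum_compl_add_sum (blowup B ρ)]
    rw [Finset.sum_eq_zero (s := blowup B ρ) fun y hy => by simp [hy], add_zero]
    refine Finset.sum_congr rfl fun y hy => ?_
    rw [Finset.mem_compl] at hy
    simp [hy, prodW]
  rw [hB, hD, ← exp_nat_mul] at h
  have h4 : exp (n * t ^ 2 / 4 - t * ρ) = exp (n * (t ^ 2 / 4)) * (exp (t * ρ))⁻¹ := by
    rw [← exp_neg, ← exp_add]
    congr 1
    ring
  rw [h4, ← div_eq_mul_inv, le_div_iff₀ (exp_pos _)]
  linarith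

theorem card_hammingBall_le {Y : Type*} [Fintype Y] {n : ℕ} (z : Fin n → Y) (ρ : ℝ) {s : ℝ}
    (hs : 0 ≤ s) :
    ((Finset.univ.filter fun y : Fin n → Y => (hammingDist y z : ℝ) < ρ).card : ℝ) ≤
      exp (s * ρ + n * (Fintype.card Y * exp (-s))) := by
  have hterm : ∀ y : Fin n → Y, exp (-s * hammingDist y z) =
      ∏ j, (if y j = z j then 1 else exp (-s)) := by
    intro y
    rw [mul_comm, exp_nat_mul, hammingDist, ← Finset.prod_const, Finset.prod_filter]
    refine Finset.prod_congr rfl fun j _ => ?_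
    by_cases h : y j = z j <;> simp [h]
  have hsum : ∑ y : Fin n → Y, exp (-s * hammingDist y z) ≤
      exp (n * (Fintype.card Y * exp (-s))) := by
    have h := Finset.prod_univ_sum (fun _ : Fin n => (Finset.univ : Finset Y))
      (fun j y => if y = z j then (1 : ℝ) else exp (-s))
    rw [Fintype.piFinset_univ] at h
    simp only [hterm]
    rw [← h]
    calc ∏ j, ∑ y, (if y = z j then (1 : ℝ) else exp (-s))
        ≤ ∏ _j : Fin n, exp (Fintype.card Y * exp (-s)) := by
          refine Finset.prod_le_prod
            (fun j _ => Finset.sum_nonneg fun y _ => by split_ifs <;> positivity)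
            fun j _ => ?_
          calc ∑ y, (if y = z j then (1 : ℝ) else exp (-s))
              ≤ ∑ y, ((if y = z j then (1 : ℝ) else 0) + exp (-s)) := by
                refine Finset.sum_le_sum fun y _ => ?_
                have := exp_pos (-s)
                split_ifs <;> linarith
            _ = Fintype.card Y * exp (-s) + 1 := by
                rw [Finset.sum_add_distrib]
                simp [add_comm]
            _ ≤ exp (Fintype.card Y * exp (-s)) := add_one_le_exp _
      _ = exp (n * (Fintype.card Y * exp (-s))) := by
          rw [Finset.prod_const, Finset.card_univ, Fintype.card_fin, ← exp_nat_mul]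
  calc ((Finset.univ.filter fun y : Fin n → Y => (hammingDist y z : ℝ) < ρ).card : ℝ)
      = ∑ y ∈ Finset.univ.filter fun y : Fin n → Y => (hammingDist y z : ℝ) < ρ, (1 : ℝ) := by
        simp
    _ ≤ ∑ y ∈ Finset.univ.filter fun y : Fin n → Y => (hammingDist y z : ℝ) < ρ,
          exp (s * ρ) * exp (-s * hammingDist y z) := by
        refine Finset.sum_le_sum fun y hy => ?_
        rw [Finset.mem_filter] at hy
        rw [← exp_add]
        refine one_le_exp ?_
        nlinarith [mul_nonneg hs (sub_nonneg.mpr hy.2.le)]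
    _ ≤ ∑ y : Fin n → Y, exp (s * ρ) * exp (-s * hammingDist y z) :=
        Finset.sum_le_sum_of_subset_of_nonneg (Finset.filter_subset _ _)
          fun y _ _ => by positivity
    _ = exp (s * ρ) * ∑ y : Fin n → Y, exp (-s * hammingDist y z) := by
        rw [Finset.mul_sum]
    _ ≤ exp (s * ρ) * exp (n * (Fintype.card Y * exp (-s))) :=
        mul_le_mul_of_nonneg_left hsum (exp_pos _).le
    _ = _ := by rw [← exp_add]

theorem card_blowup_le {Y : Type*} [Fintype Y] {n : ℕ} (B : Finset (Fin n → Y)) (ρ : ℝ)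
    {s : ℝ} (hs : 0 ≤ s) :
    ((blowup B ρ).card : ℝ) ≤ B.card * exp (s * ρ + n * (Fintype.card Y * exp (-s))) := by
  have hsub : blowup B ρ ⊆
      B.biUnion fun z => Finset.univ.filter fun y => (hammingDist y z : ℝ) < ρ := by
    intro y hy
    simpa [blowup] using hy
  calc ((blowup B ρ).card : ℝ)
      ≤ ∑ z ∈ B, ((Finset.univ.filter fun y => (hammingDist y z : ℝ) < ρ).card : ℝ) := by
        exact_mod_cast (Finset.card_le_card hsub).trans Finset.card_biUnion_le
    _ ≤ ∑ _z ∈ B, exp (s * ρ + n * (Fintype.card Y * exp (-s))) :=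
        Finset.sum_le_sum fun z _ => card_hammingBall_le z ρ hs
    _ = _ := by rw [Finset.sum_const, nsmul_eq_mul]

theorem exists_card_eq_gimg {X Y : Type*} [Fintype Y] {W : X → Y → ℝ} (hW : isChannel W)
    {n : ℕ} (A : Finset (Fin n → X)) {η : ℝ} (hη : η ≤ 1) :
    ∃ B : Finset (Fin n → Y), B.card = gimg W A η ∧ ∀ x ∈ A, η ≤ prodWSet W x B :=
  Nat.sInf_mem (s := {m | ∃ B : Finset (Fin n → Y), B.card = m ∧
    ∀ x ∈ A, η ≤ prodWSet W x B})
    ⟨_, Finset.univ, rfl, fun x _ => by rwa [prodWSet_univ hW x]⟩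

theorem gimg_le_card {X Y : Type*} [Fintype Y] {W : X → Y → ℝ} {n : ℕ}
    {A : Finset (Fin n → X)} {η : ℝ} {B : Finset (Fin n → Y)}
    (hB : ∀ x ∈ A, η ≤ prodWSet W x B) : gimg W A η ≤ B.card :=
  Nat.sInf_le ⟨B, rfl, hB⟩

theorem gimg_pos {X Y : Type*} [Fintype Y] {W : X → Y → ℝ} (hW : isChannel W) {n : ℕ}
    {A : Finset (Fin n → X)} (hA : A.Nonempty) {η : ℝ} (h0 : 0 < η) (h1 : η ≤ 1) :
    0 < gimg W A η := by
  obtain ⟨B, hB, hBA⟩ := exists_card_eq_gimg hW A h1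
  obtain ⟨x, hx⟩ := hA
  rw [← hB, Finset.card_pos]
  by_contra hne
  rw [Finset.not_nonempty_iff_eq_empty] at hne
  have := hBA x hx
  simp only [hne, prodWSet, Finset.sum_empty] at this
  linarith

theorem gimg_mono {X Y : Type*} [Fintype Y] {W : X → Y → ℝ} (hW : isChannel W) {n : ℕ}
    (A : Finset (Fin n → X)) {η η' : ℝ} (h : η ≤ η') (h1 : η' ≤ 1) :
    gimg W A η ≤ gimg W A η' := by
  obtain ⟨B, hB, hBA⟩ := exists_card_eq_gimg hW A h1
  rw [← hB]
  exact gimg_le_card fun x hx => h.trans (hBA x hx)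

/-- Comparison of image sizes at block length `n = u ^ 8`. -/
theorem gimg_le_mul_exp {X Y : Type*} [Fintype Y] [Nonempty Y] {W : X → Y → ℝ}
    (hW : isChannel W) {n : ℕ} {u : ℝ} (hu : 0 < u) (hun : u ^ 8 = n)
    (A : Finset (Fin n → X)) {α β : ℝ} (hα : 1 / (n : ℝ) ^ 2 ≤ α) (hα1 : α ≤ 1)
    (hβ : β ≤ 1 - u ^ 16 * exp (-u ^ 4)) :
    (gimg W A β : ℝ) ≤ gimg W A α * exp (u ^ 7 + n * (Fintype.card Y * exp (-u))) := by
  obtain ⟨B, hB, hBA⟩ := exists_card_eq_gimg hW A hα1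
  have hn2 : (n : ℝ) ^ 2 = u ^ 16 := by rw [← hun]; ring
  have himg : ∀ x ∈ A, β ≤ prodWSet W x (blowup B (u ^ 6)) := by
    intro x hx
    have h := prodWSet_mul_one_sub_blowup_le hW x B (u ^ 6) (t := 2 / u ^ 2) (by positivity)
    have hexp : (n : ℝ) * (2 / u ^ 2) ^ 2 / 4 - 2 / u ^ 2 * u ^ 6 = -u ^ 4 := by
      rw [← hun]
      field_simp
      ring
    rw [hexp] at h
    have hx1 := hα.trans (hBA x hx)
    rw [hn2] at hx1
    have hu16 : 0 < u ^ 16 := by positivity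
    by_contra hcon
    push Not at hcon
    have hD : u ^ 16 * exp (-u ^ 4) < 1 - prodWSet W x (blowup B (u ^ 6)) := by linarith
    have hD0 : 0 < 1 - prodWSet W x (blowup B (u ^ 6)) := lt_trans (by positivity) hD
    have h1 : (1 - prodWSet W x (blowup B (u ^ 6))) * (1 / u ^ 16) ≤ exp (-u ^ 4) :=
      (mul_le_mul_of_nonneg_left hx1 hD0.le).trans h
    rw [mul_one_div, div_le_iff₀ hu16] at h1
    linarith
  calc (gimg W A β : ℝ) ≤ (blowup B (u ^ 6)).card := by exact_mod_cast gimg_le_card himg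
    _ ≤ B.card * exp (u * u ^ 6 + n * (Fintype.card Y * exp (-u))) :=
        card_blowup_le B (u ^ 6) hu.le
    _ = _ := by rw [hB]; ring_nf

open Filter in
/-- Lemma 3, uniform version: the same `β_n → 1` and `τ_n → 0` work
uniformly over all `α ∈ [1/n², α']`. -/
theorem stmt_5 {X Y : Type*} [Fintype X] [Fintype Y] [Nonempty X] [Nonempty Y]
    (W : X → Y → ℝ) (hW : isChannel W)
    (α' : ℝ) (hα' : α' ∈ Set.Ioo (0:ℝ) 1) :
    ∃ β τ : ℕ → ℝ,
      (∀ n, β n ∈ Set.Ioo (0:ℝ) 1) ∧ Tendsto β atTop (nhds 1) ∧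
      (∀ n, 0 ≤ τ n) ∧ Tendsto τ atTop (nhds 0) ∧
      ∃ N : ℕ, ∀ n : ℕ, N ≤ n →
        ∀ α : ℝ, α ∈ Set.Icc (1 / (n:ℝ)^2) α' →
          ∀ A' : Finset (Fin n → X), A'.Nonempty →
            0 ≤ (1 / (n:ℝ)) * Real.logb 2 (gimg W A' (β n)) -
                  (1 / (n:ℝ)) * Real.logb 2 (gimg W A' α) ∧
            (1 / (n:ℝ)) * Real.logb 2 (gimg W A' (β n)) -
                  (1 / (n:ℝ)) * Real.logb 2 (gimg W A' α) ≤ τ n := by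
  set u : ℕ → ℝ := fun n => (n : ℝ) ^ (1 / 8 : ℝ) with hu
  have hu0 : ∀ n, 0 ≤ u n := fun n => by positivity
  have hulim : Tendsto u atTop atTop :=
    (tendsto_rpow_atTop (by norm_num)).comp tendsto_natCast_atTop_atTop
  have hun : ∀ n, u n ^ 8 = n := fun n => by
    rw [hu, ← Real.rpow_natCast, ← Real.rpow_mul (Nat.cast_nonneg n)]
    norm_num
  have hblim : Tendsto (fun n => 1 - (u n ^ 16 + 1) * exp (-u n ^ 4)) atTop (nhds 1) := by
    have h4 : Tendsto (fun n => u n ^ 4) atTop atTop :=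
      (tendsto_pow_atTop (by norm_num)).comp hulim
    have h1 := (tendsto_pow_mul_exp_neg_atTop_nhds_zero 4).comp h4
    have h0 := (tendsto_pow_mul_exp_neg_atTop_nhds_zero 0).comp h4
    have h2 := (h1.add h0).const_sub 1
    simp only [add_zero, sub_zero] at h2
    refine h2.congr fun n => ?_
    simp only [Function.comp_apply]
    ring
  refine ⟨fun n => max (1 / 2) (1 - (u n ^ 16 + 1) * exp (-u n ^ 4)),
    fun n => ((u n)⁻¹ + Fintype.card Y * exp (-u n)) / Real.log 2, fun n => ⟨?_, ?_⟩, ?_,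
    fun n => ?_, ?_, ?_⟩
  · exact lt_max_of_lt_left (by norm_num)
  · have := hu0 n
    exact max_lt (by norm_num) (sub_lt_self _ (by positivity))
  · have := (tendsto_const_nhds (x := (1 / 2 : ℝ))).max hblim
    norm_num at this ⊢
    exact this
  · have := hu0 n
    have := Real.log_pos one_lt_two
    positivity
  · have h1 := tendsto_inv_atTop_zero.comp hulim
    have h2 := (tendsto_exp_neg_atTop_nhds_zero.comp hulim).const_mul (Fintype.card Y : ℝ)
    have h3 := (h1.add h2).div_const (Real.log 2)
    simpa using h3
  · have hev : ∀ᶠ n in atTop, max (1 / 2) α' < 1 - (u n ^ 16 + 1) * exp (-u n ^ 4) :=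
      hblim.eventually_const_lt (max_lt (by norm_num) hα'.2)
    obtain ⟨N, hN⟩ := eventually_atTop.mp (hev.and (eventually_gt_atTop 0))
    refine ⟨N, fun n hn α hα A hA => ?_⟩
    obtain ⟨hb, hnpos⟩ := hN n hn
    have hn0 : (0 : ℝ) < n := Nat.cast_pos.mpr hnpos
    have hupos : 0 < u n := Real.rpow_pos_of_pos hn0 _
    dsimp only
    rw [max_eq_right ((le_max_left _ _).trans hb.le)]
    set b := 1 - (u n ^ 16 + 1) * exp (-u n ^ 4) with hbdef
    have hexp := exp_pos (-u n ^ 4)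
    have hb1 : b ≤ 1 - u n ^ 16 * exp (-u n ^ 4) := by rw [hbdef]; linarith
    have hb2 : b ≤ 1 := hb1.trans (sub_le_self _ (by positivity))
    have hαb : α ≤ b := hα.2.trans ((le_max_right _ _).trans hb.le)
    have hαpos : 0 < α := lt_of_lt_of_le (by positivity) hα.1
    have hgα : (0 : ℝ) < gimg W A α := by exact_mod_cast gimg_pos hW hA hαpos (hαb.trans hb2)
    have hgb : (0 : ℝ) < gimg W A b := by
      exact_mod_cast gimg_pos hW hA (hαpos.trans_le hαb) hb2
    have hmono : (gimg W A α : ℝ) ≤ gimg W A b := by exact_mod_cast gimg_mono hW A hαb hb2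
    have hle := gimg_le_mul_exp hW hupos (hun n) A hα.1 (hαb.trans hb2) hb1
    rw [← mul_sub]
    constructor
    · exact mul_nonneg (by positivity)
        (sub_nonneg.mpr (Real.logb_le_logb_of_le one_lt_two hgα hmono))
    · have hlog := Real.log_le_log hgb hle
      rw [Real.log_mul hgα.ne' (exp_pos _).ne', Real.log_exp] at hlog
      have hl2 := Real.log_pos one_lt_two
      rw [Real.logb, Real.logb, ← sub_div, ← mul_div_assoc]
      refine div_le_div_of_nonneg_right ?_ hl2.le
      rw [one_div, inv_mul_le_iff₀ hn0]
      have h7 : (n : ℝ) * (u n)⁻¹ = u n ^ 7 := by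
        rw [← hun n]
        field_simp
      rw [mul_add, h7]
      linarith
end

section
/- Fix the channel W. For any sequence (α_n) with α_n ∈ (0,1] for all n and (−log₂ α_n)/n → 0 as n → ∞, there exist sequences τ_n ≥ 0 with τ_n → 0 and β_n ∈ (0,1) with β_n → 1 such that for all sufficiently large n and every nonempty A ⊆ 𝒳ⁿ, there exists a nonempty A′ ⊆ A satisfying |A′|/|A| ≥ (1 − 1/n)·α_n and (1/n)·log₂ gⁿ(A′, β_n) ≤ (1/n)·log₂ ḡⁿ(A, α_n) + τ_n. Moreover, if α_n ≥ 1/n for all n, then β_n and τ_n can be chosen not depending on the sequence (α_n). -/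
open scoped BigOperators Classical
open Finset Real

section ConcentrationOfMeasure

lemma mul_add_mul_le_cosh {x y u v M t : ℝ} (hx : 0 ≤ x) (hy : 0 ≤ y)
    (hxu : x * u ≤ M) (hyv : y * v ≤ M) (hM : 0 ≤ M)
    (hxy : x ≤ Real.exp t * y) (hyx : y ≤ Real.exp t * x) :
    x * v + y * u ≤ 2 * (M * Real.cosh t) := by
  have hc : 0 < Real.cosh t := Real.cosh_pos t
  rcases hx.eq_or_lt with rfl | hx
  · have : y = 0 := le_antisymm (by simpa using hyx) hy
    subst this
    simp only [zero_mul, add_zero]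
    positivity
  rcases hy.eq_or_lt with rfl | hy
  · simp only [mul_zero] at hxy
    linarith
  have hu : u ≤ M / x := by rw [le_div_iff₀ hx]; linarith
  have hv : v ≤ M / y := by rw [le_div_iff₀ hy]; linarith
  have key : x / y + y / x ≤ 2 * Real.cosh t := by
    have het : Real.exp t * Real.exp (-t) = 1 := by rw [← Real.exp_add]; simp
    have h1 : x / y ≤ Real.exp t := by rwa [div_le_iff₀ hy]
    have h2 : Real.exp (-t) ≤ x / y := by
      rw [le_div_iff₀ hy]
      calc Real.exp (-t) * y ≤ Real.exp (-t) * (Real.exp t * x) := by gcongr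
        _ = x := by rw [← mul_assoc, mul_comm (Real.exp (-t)), het, one_mul]
    have hr : 0 < x / y := by positivity
    have h3 : y / x = (x / y)⁻¹ := by rw [inv_div]
    rw [h3, Real.cosh_eq]
    have h4 : x / y * (x / y)⁻¹ = 1 := mul_inv_cancel₀ hr.ne'
    have h5 : 0 ≤ (Real.exp t - x / y) * (x / y - Real.exp (-t)) :=
      mul_nonneg (by linarith) (by linarith)
    have h6 : (x / y + (x / y)⁻¹) * (x / y) ≤ (Real.exp t + Real.exp (-t)) * (x / y) := by
      nlinarith
    have := le_of_mul_le_mul_right h6 hr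
    linarith
  calc x * v + y * u ≤ x * (M / y) + y * (M / x) := by gcongr
    _ = M * (x / y + y / x) := by ring
    _ ≤ M * (2 * Real.cosh t) := by gcongr
    _ = 2 * (M * Real.cosh t) := by ring

/-- If `f` changes by at most `1` when one coordinate is modified, then the product of the Laplace
transforms of `f` and `-f` under a product distribution is at most `cosh t ^ n`. -/
lemma laplace_mul_laplace_neg_le {Y : Type*} [Fintype Y] {t : ℝ} (ht : 0 ≤ t) {n : ℕ}
    (p : Fin n → Y → ℝ) (hp : ∀ j y, 0 ≤ p j y) (hsum : ∀ j, ∑ y, p j y = 1)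
    (f : (Fin n → Y) → ℝ) (hf : ∀ y j v, f (Function.update y j v) ≤ f y + 1) :
    (∑ y, (∏ j, p j (y j)) * Real.exp (t * f y)) *
      (∑ y, (∏ j, p j (y j)) * Real.exp (-(t * f y))) ≤ Real.cosh t ^ n := by
  induction n with
  | zero =>
    simp [← Real.exp_add]
  | succ n ih =>
    set F : Y → ℝ := fun a => ∑ y : Fin n → Y, (∏ j, p j.succ (y j)) *
      Real.exp (t * f (Fin.cons a y)) with hF
    set G : Y → ℝ := fun a => ∑ y : Fin n → Y, (∏ j, p j.succ (y j)) *
      Real.exp (-(t * f (Fin.cons a y))) with hG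
    have split : ∀ g : (Fin (n + 1) → Y) → ℝ,
        ∑ y, (∏ j, p j (y j)) * g y =
          ∑ a, p 0 a * ∑ y : Fin n → Y, (∏ j, p j.succ (y j)) * g (Fin.cons a y) := by
      intro g
      rw [← Equiv.sum_comp (Fin.consEquiv fun _ => Y), Fintype.sum_prod_type]
      refine Finset.sum_congr rfl fun a _ => ?_
      rw [Finset.mul_sum]
      refine Finset.sum_congr rfl fun y _ => ?_
      simp [Fin.consEquiv, Fin.prod_univ_succ, mul_assoc]
    have hFG : ∀ a, F a * G a ≤ Real.cosh t ^ n := fun a =>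
      ih (fun j => p j.succ) (fun j => hp _) (fun j => hsum _) (fun y => f (Fin.cons a y))
        (fun y j v => by rw [Fin.cons_update]; exact hf _ _ _)
    have hprod : ∀ y : Fin n → Y, 0 ≤ ∏ j, p j.succ (y j) := fun y =>
      Finset.prod_nonneg fun j _ => hp _ _
    have hF0 : ∀ a, 0 ≤ F a := fun a => Finset.sum_nonneg fun y _ =>
      mul_nonneg (hprod y) (Real.exp_pos _).le
    have hFF : ∀ a b, F a ≤ Real.exp t * F b := by
      intro a b
      simp only [hF, Finset.mul_sum]
      refine Finset.sum_le_sum fun y _ => ?_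
      have h1 : f (Fin.cons a y) ≤ f (Fin.cons b y) + 1 := by
        have := hf (Fin.cons b y) 0 a
        rwa [Fin.update_cons_zero] at this
      have h2 : Real.exp (t * f (Fin.cons a y)) ≤
          Real.exp t * Real.exp (t * f (Fin.cons b y)) := by
        rw [← Real.exp_add]
        exact Real.exp_le_exp.2 (by nlinarith)
      calc _ ≤ (∏ j, p j.succ (y j)) * (Real.exp t * Real.exp (t * f (Fin.cons b y))) :=
            mul_le_mul_of_nonneg_left h2 (hprod y)
        _ = _ := by ring
    have hc : 0 < Real.cosh t := Real.cosh_pos t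
    rw [split, split]
    change (∑ a, p 0 a * F a) * (∑ b, p 0 b * G b) ≤ _
    have e1 : (∑ a, p 0 a * F a) * (∑ b, p 0 b * G b) =
        ∑ a, ∑ b, p 0 a * p 0 b * (F a * G b) := by
      rw [Finset.sum_mul_sum]
      exact Finset.sum_congr rfl fun a _ => Finset.sum_congr rfl fun b _ => by ring
    have e2 : (∑ a, p 0 a * F a) * (∑ b, p 0 b * G b) =
        ∑ a, ∑ b, p 0 a * p 0 b * (F b * G a) := by
      rw [e1, Finset.sum_comm]
      exact Finset.sum_congr rfl fun a _ => Finset.sum_congr rfl fun b _ => by ring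
    have e3 : 2 * ((∑ a, p 0 a * F a) * (∑ b, p 0 b * G b)) ≤
        ∑ a, ∑ b, p 0 a * p 0 b * (2 * (Real.cosh t ^ n * Real.cosh t)) := by
      rw [two_mul]
      nth_rewrite 1 [e1]
      rw [e2]
      simp only [← Finset.sum_add_distrib, ← mul_add]
      refine Finset.sum_le_sum fun a _ => Finset.sum_le_sum fun b _ => ?_
      exact mul_le_mul_of_nonneg_left
        (mul_add_mul_le_cosh (hF0 a) (hF0 b) (hFG a) (hFG b) (by positivity) (hFF a b) (hFF b a))
        (mul_nonneg (hp _ _) (hp _ _))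
    have e4 : ∑ a, ∑ b, p 0 a * p 0 b * (2 * (Real.cosh t ^ n * Real.cosh t)) =
        2 * (Real.cosh t ^ n * Real.cosh t) := by
      simp only [← Finset.sum_mul, ← Finset.mul_sum, hsum, mul_one, one_mul]
    rw [pow_succ]
    linarith

lemma hammingDist_update_le {Y : Type*} {n : ℕ} (y b : Fin n → Y) (j : Fin n) (v : Y) :
    hammingDist (Function.update y j v) b ≤ hammingDist y b + 1 := by
  unfold hammingDist
  refine (Finset.card_le_card (t := insert j (Finset.univ.filter fun i => y i ≠ b i)) ?_).trans
    (Finset.card_insert_le _ _)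
  intro i hi
  by_cases hij : i = j
  · simp [hij]
  · simpa [hij, Function.update_of_ne hij] using hi

/-- The sequences within Hamming distance `r` of `B`. -/
noncomputable def hammingBlowUp {Y : Type*} [Fintype Y] {n : ℕ} (B : Finset (Fin n → Y)) (r : ℝ) :
    Finset (Fin n → Y) :=
  Finset.univ.filter fun y => ∃ b ∈ B, (hammingDist y b : ℝ) ≤ r

/-- The blowing-up lemma for product distributions. -/
lemma one_sub_le_sum_hammingBlowUp {Y : Type*} [Fintype Y] {n : ℕ}
    (p : Fin n → Y → ℝ) (hp : ∀ j y, 0 ≤ p j y) (hsum : ∀ j, ∑ y, p j y = 1)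
    {B : Finset (Fin n → Y)} {c : ℝ} (hc : 0 < c) (hB : c ≤ ∑ y ∈ B, ∏ j, p j (y j))
    {δ : ℝ} (hδ : 0 ≤ δ) :
    1 - Real.exp (-(n * δ ^ 2 / 2)) / c ≤ ∑ y ∈ hammingBlowUp B (n * δ), ∏ j, p j (y j) := by
  have hne : B.Nonempty := by
    rw [Finset.nonempty_iff_ne_empty]
    rintro rfl
    simp only [Finset.sum_empty] at hB
    linarith
  have hP : ∀ y : Fin n → Y, 0 ≤ ∏ j, p j (y j) := fun y => Finset.prod_nonneg fun j _ => hp _ _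
  set f : (Fin n → Y) → ℝ := fun y => B.inf' hne fun b => (hammingDist y b : ℝ) with hfdef
  have hf : ∀ y j v, f (Function.update y j v) ≤ f y + 1 := by
    intro y j v
    obtain ⟨b, hb, hfb⟩ := Finset.exists_mem_eq_inf' hne fun b => (hammingDist y b : ℝ)
    have h1 : f (Function.update y j v) ≤ hammingDist (Function.update y j v) b :=
      Finset.inf'_le (fun b => (hammingDist (Function.update y j v) b : ℝ)) hb
    have h2 : (hammingDist (Function.update y j v) b : ℝ) ≤ hammingDist y b + 1 := by
      exact_mod_cast hammingDist_update_le y b j v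
    have h3 : f y = hammingDist y b := hfb
    linarith
  have main := laplace_mul_laplace_neg_le hδ p hp hsum f hf
  have hneg : c ≤ ∑ y, (∏ j, p j (y j)) * Real.exp (-(δ * f y)) := by
    refine hB.trans ?_
    refine le_trans (Finset.sum_le_sum fun y hy => ?_) (Finset.sum_le_sum_of_subset_of_nonneg
      (Finset.subset_univ B) fun y _ _ => mul_nonneg (hP y) (Real.exp_pos _).le)
    have h1 : f y ≤ hammingDist y y := Finset.inf'_le (fun b => (hammingDist y b : ℝ)) hy
    rw [hammingDist_self, Nat.cast_zero] at h1
    have h2 : 1 ≤ Real.exp (-(δ * f y)) := Real.one_le_exp (by nlinarith)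
    nlinarith [hP y]
  have hpos : Real.exp (n * δ ^ 2) * (1 - ∑ y ∈ hammingBlowUp B (n * δ), ∏ j, p j (y j)) ≤
      ∑ y, (∏ j, p j (y j)) * Real.exp (δ * f y) := by
    have htot : ∑ y : Fin n → Y, ∏ j, p j (y j) = 1 := by
      have := Finset.prod_univ_sum (fun _ : Fin n => (Finset.univ : Finset Y)) p
      rw [Fintype.piFinset_univ] at this
      rw [← this]
      simp [hsum]
    have hcompl : 1 - ∑ y ∈ hammingBlowUp B (n * δ), ∏ j, p j (y j) =
        ∑ y ∈ (hammingBlowUp B (n * δ))ᶜ, ∏ j, p j (y j) := by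
      rw [← htot, ← Finset.sum_add_sum_compl (hammingBlowUp B (n * δ))]
      ring
    rw [hcompl, Finset.mul_sum]
    refine le_trans (Finset.sum_le_sum fun y hy => ?_) (Finset.sum_le_sum_of_subset_of_nonneg
      (Finset.subset_univ _) fun y _ _ => mul_nonneg (hP y) (Real.exp_pos _).le)
    have hfy : n * δ ≤ f y := by
      refine Finset.le_inf' _ _ fun b hb => ?_
      simp only [hammingBlowUp, Finset.mem_compl, Finset.mem_filter, Finset.mem_univ, true_and,
        not_exists, not_and, not_le] at hy
      exact (hy b hb).le
    rw [mul_comm]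
    refine mul_le_mul_of_nonneg_left (Real.exp_le_exp.2 ?_) (hP y)
    nlinarith
  have hcosh : Real.cosh δ ^ n ≤ Real.exp (n * δ ^ 2 / 2) := by
    calc Real.cosh δ ^ n ≤ Real.exp (δ ^ 2 / 2) ^ n :=
          pow_le_pow_left₀ (Real.cosh_pos δ).le (Real.cosh_le_exp_half_sq δ) n
      _ = Real.exp (n * δ ^ 2 / 2) := by rw [← Real.exp_nat_mul]; ring_nf
  have hS : 0 ≤ ∑ y, (∏ j, p j (y j)) * Real.exp (δ * f y) :=
    Finset.sum_nonneg fun y _ => mul_nonneg (hP y) (Real.exp_pos _).le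
  set D := 1 - ∑ y ∈ hammingBlowUp B (n * δ), ∏ j, p j (y j) with hD
  have h1 : Real.exp (n * δ ^ 2) * D * c ≤ Real.exp (n * δ ^ 2 / 2) :=
    calc Real.exp (n * δ ^ 2) * D * c
        ≤ (∑ y, (∏ j, p j (y j)) * Real.exp (δ * f y)) * c := by gcongr
      _ ≤ _ := mul_le_mul_of_nonneg_left hneg hS
      _ ≤ _ := main.trans hcosh
  have h2 : D * c ≤ Real.exp (-(n * δ ^ 2 / 2)) := by
    have h3 : Real.exp (n * δ ^ 2 / 2) = Real.exp (n * δ ^ 2) * Real.exp (-(n * δ ^ 2 / 2)) := by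
      rw [← Real.exp_add]; ring_nf
    rw [h3, mul_assoc] at h1
    exact le_of_mul_le_mul_left h1 (Real.exp_pos _)
  have h4 : D ≤ Real.exp (-(n * δ ^ 2 / 2)) / c := by rwa [le_div_iff₀ hc]
  linarith

lemma sum_pow_hammingDist_le {Y : Type*} [Fintype Y] {n : ℕ} (b : Fin n → Y) {s : ℝ}
    (hs : 0 ≤ s) :
    ∑ y : Fin n → Y, s ^ hammingDist y b ≤ Real.exp (n * (Fintype.card Y * s)) := by
  have h1 : ∀ y : Fin n → Y, s ^ hammingDist y b = ∏ j, if y j ≠ b j then s else 1 := by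
    intro y
    rw [hammingDist, Finset.prod_ite]
    simp
  have h2 := Finset.prod_univ_sum (fun _ : Fin n => (Finset.univ : Finset Y))
    (fun j v => if v ≠ b j then s else 1)
  rw [Fintype.piFinset_univ] at h2
  simp only [h1]
  rw [← h2, Real.exp_nat_mul]
  calc ∏ j, ∑ v, (if v ≠ b j then s else 1)
      ≤ ∏ _j : Fin n, Real.exp (Fintype.card Y * s) := by
        refine Finset.prod_le_prod (fun j _ => Finset.sum_nonneg fun v _ => ?_) fun j _ => ?_
        · split_ifs <;> positivity
        · calc ∑ v, (if v ≠ b j then s else 1) ≤ ∑ v, (s + if v = b j then 1 else 0) := by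
                refine Finset.sum_le_sum fun v _ => ?_
                by_cases h : v = b j <;> simp [h, hs]
            _ = Fintype.card Y * s + 1 := by simp [Finset.sum_add_distrib]
            _ ≤ _ := Real.add_one_le_exp _
    _ = _ := by simp

lemma card_hammingBlowUp_le {Y : Type*} [Fintype Y] {n : ℕ} (B : Finset (Fin n → Y)) {δ : ℝ}
    (hδ : 0 < δ) (hδ1 : δ ≤ 1) :
    ((hammingBlowUp B (n * δ)).card : ℝ) ≤
      B.card * Real.exp (n * (Real.negMulLog δ + Fintype.card Y * δ)) := by
  have h1 : ((hammingBlowUp B (n * δ)).card : ℝ) ≤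
      ∑ b ∈ B, ∑ y : Fin n → Y, Real.exp (n * Real.negMulLog δ) * δ ^ hammingDist y b := by
    rw [Finset.sum_comm, Finset.card_eq_sum_ones, Nat.cast_sum]
    refine le_trans (Finset.sum_le_sum fun y hy => ?_) (Finset.sum_le_sum_of_subset_of_nonneg
      (Finset.subset_univ _) fun y _ _ => Finset.sum_nonneg fun b _ => by positivity)
    obtain ⟨b, hb, hyb⟩ : ∃ b ∈ B, (hammingDist y b : ℝ) ≤ n * δ := by
      simpa [hammingBlowUp] using hy
    refine le_trans ?_ (Finset.single_le_sum (f := fun b =>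
      Real.exp (n * Real.negMulLog δ) * δ ^ hammingDist y b) (fun b _ => by positivity) hb)
    have h2 : δ ^ hammingDist y b = Real.exp (hammingDist y b * Real.log δ) := by
      rw [Real.exp_nat_mul, Real.exp_log hδ]
    rw [Nat.cast_one, h2, ← Real.exp_add]
    refine Real.one_le_exp ?_
    rw [Real.negMulLog]
    nlinarith [Real.log_nonpos hδ.le hδ1]
  refine h1.trans ?_
  calc ∑ b ∈ B, ∑ y : Fin n → Y, Real.exp (n * Real.negMulLog δ) * δ ^ hammingDist y b
      ≤ ∑ _b ∈ B, Real.exp (n * Real.negMulLog δ) * Real.exp (n * (Fintype.card Y * δ)) := by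
        refine Finset.sum_le_sum fun b _ => ?_
        rw [← Finset.mul_sum]
        exact mul_le_mul_of_nonneg_left (sum_pow_hammingDist_le b hδ.le) (Real.exp_pos _).le
    _ = _ := by rw [Finset.sum_const, nsmul_eq_mul, ← Real.exp_add, mul_add]

end ConcentrationOfMeasure

section Images

open Filter

lemma sum_outDist {X Y : Type*} (W : X → Y → ℝ) {n : ℕ} (A : Finset (Fin n → X)) (B : Finset (Fin n → Y)) :
    ∑ y ∈ B, outDist W A y = (A.card : ℝ)⁻¹ * ∑ x ∈ A, prodWSet W x B := by
  unfold outDist prodWSet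
  rw [← Finset.mul_sum, Finset.sum_comm]

variable {X Y : Type*} [Fintype Y]

lemma prodW_nonneg {W : X → Y → ℝ} (hW : isChannel W) {n : ℕ} (x : Fin n → X) (y : Fin n → Y) :
    0 ≤ prodW W x y :=
  Finset.prod_nonneg fun j _ => (hW (x j)).1 (y j)

lemma sum_prodW {W : X → Y → ℝ} (hW : isChannel W) {n : ℕ} (x : Fin n → X) :
    ∑ y, prodW W x y = 1 := by
  have h := Finset.prod_univ_sum (fun _ : Fin n => (Finset.univ : Finset Y)) fun j => W (x j)
  rw [Fintype.piFinset_univ] at h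
  unfold prodW
  rw [← h]
  simp [(hW _).2]

lemma prodWSet_le_one {W : X → Y → ℝ} (hW : isChannel W) {n : ℕ} (x : Fin n → X)
    (B : Finset (Fin n → Y)) : prodWSet W x B ≤ 1 := by
  rw [← sum_prodW hW x]
  exact Finset.sum_le_sum_of_subset_of_nonneg (Finset.subset_univ B) fun y _ _ =>
    prodW_nonneg hW x y

lemma exists_card_eq_gbar {W : X → Y → ℝ} (hW : isChannel W) {n : ℕ} {A : Finset (Fin n → X)}
    (hA : A.Nonempty) {η : ℝ} (hη : η ≤ 1) :
    ∃ B : Finset (Fin n → Y), B.card = gbar W A η ∧ η ≤ ∑ y ∈ B, outDist W A y := by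
  have hne : {m | ∃ B : Finset (Fin n → Y), B.card = m ∧ η ≤ ∑ y ∈ B, outDist W A y}.Nonempty := by
    refine ⟨_, Finset.univ, rfl, hη.trans (le_of_eq ?_)⟩
    have hA' : (A.card : ℝ) ≠ 0 := by exact_mod_cast hA.card_pos.ne'
    rw [sum_outDist]
    simp [prodWSet, sum_prodW hW, hA']
  exact Nat.sInf_mem hne

/-- A quasi-image of `A` at level `a` is an image at level `ε * a` of a subset of `A` of
relative size at least `(1 - ε) * a`. -/
lemma le_card_filter_prodWSet {W : X → Y → ℝ} (hW : isChannel W) {n : ℕ}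
    {A : Finset (Fin n → X)} (hA : A.Nonempty) {B : Finset (Fin n → Y)} {a ε : ℝ} (ha : 0 ≤ a)
    (hε : 0 ≤ ε) (hB : a ≤ ∑ y ∈ B, outDist W A y) :
    (1 - ε) * a ≤ ((A.filter fun x => ε * a ≤ prodWSet W x B).card : ℝ) / A.card := by
  have hA' : (0 : ℝ) < A.card := by exact_mod_cast hA.card_pos
  rw [sum_outDist, inv_mul_eq_div, le_div_iff₀ hA'] at hB
  rw [le_div_iff₀ hA']
  have h1 : ∑ x ∈ A, prodWSet W x B ≤
      ∑ x ∈ A, ((if ε * a ≤ prodWSet W x B then 1 else 0) + ε * a) := by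
    refine Finset.sum_le_sum fun x _ => ?_
    have h2 := prodWSet_le_one hW x B
    have h3 : 0 ≤ ε * a := mul_nonneg hε ha
    split_ifs <;> linarith
  rw [Finset.sum_add_distrib, Finset.sum_const, nsmul_eq_mul, Finset.sum_boole] at h1
  linarith

/-- Passing from a quasi-image at level `a` to an image at level `1 - 1 / n`. -/
lemma exists_subset_logb_gimg_le {W : X → Y → ℝ} (hW : isChannel W) {n : ℕ} (hn : 2 ≤ n)
    {A : Finset (Fin n → X)} (hA : A.Nonempty) {a : ℝ} (ha : 0 < a) (ha1 : a ≤ 1)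
    {δ : ℝ} (hδ : 0 < δ) (hδ1 : δ ≤ 1) (hδa : 2 * Real.log n - Real.log a ≤ n * δ ^ 2 / 2) :
    ∃ A' : Finset (Fin n → X), A' ⊆ A ∧ A'.Nonempty ∧
      (1 - 1 / (n : ℝ)) * a ≤ (A'.card : ℝ) / (A.card : ℝ) ∧
      (1 / (n : ℝ)) * Real.logb 2 (gimg W A' (1 - 1 / (n : ℝ))) ≤
        (1 / (n : ℝ)) * Real.logb 2 (gbar W A a) +
          (Real.negMulLog δ + Fintype.card Y * δ) / Real.log 2 := by
  have hn2 : (2 : ℝ) ≤ n := by exact_mod_cast hn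
  have hn0 : (0 : ℝ) < n := by linarith
  have hlog2 : 0 < Real.log 2 := Real.log_pos one_lt_two
  obtain ⟨B, hBcard, hB⟩ := exists_card_eq_gbar hW hA ha1
  have hsize := le_card_filter_prodWSet hW hA ha.le (one_div_nonneg.2 hn0.le) hB
  have hτ : 0 ≤ Real.negMulLog δ + Fintype.card Y * δ := by
    have := Real.negMulLog_nonneg hδ.le hδ1
    positivity
  set A' := A.filter fun x => 1 / (n : ℝ) * a ≤ prodWSet W x B with hA'
  refine ⟨A', Finset.filter_subset _ _, ?_, hsize, ?_⟩
  · rw [Finset.nonempty_iff_ne_empty]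
    intro h
    rw [h, Finset.card_empty, Nat.cast_zero, zero_div] at hsize
    have h1 : 1 / (n : ℝ) < 1 := by rw [div_lt_one hn0]; linarith
    nlinarith
  have hBne : B.Nonempty := by
    rw [Finset.nonempty_iff_ne_empty]
    rintro rfl
    rw [Finset.sum_empty] at hB
    linarith
  have hBpos : (0 : ℝ) < B.card := by exact_mod_cast hBne.card_pos
  have himg : gimg W A' (1 - 1 / (n : ℝ)) ≤ (hammingBlowUp B (n * δ)).card := by
    refine Nat.sInf_le ⟨_, rfl, fun x hx => ?_⟩
    have hx' : 1 / (n : ℝ) * a ≤ prodWSet W x B := (Finset.mem_filter.1 hx).2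
    have hc : 0 < 1 / (n : ℝ) * a := by positivity
    refine le_trans ?_ (one_sub_le_sum_hammingBlowUp (fun j => W (x j)) (fun j => (hW (x j)).1)
      (fun j => (hW (x j)).2) hc hx' hδ.le)
    refine sub_le_sub_left ?_ 1
    rw [div_le_iff₀ hc]
    have h1 : 1 / (n : ℝ) * (1 / (n : ℝ) * a) = Real.exp (Real.log a - 2 * Real.log n) := by
      rw [Real.exp_sub, two_mul, Real.exp_add, Real.exp_log ha, Real.exp_log hn0]
      field_simp
    rw [h1]
    exact Real.exp_le_exp.2 (by linarith)
  have hlog : Real.logb 2 (gimg W A' (1 - 1 / (n : ℝ))) ≤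
      Real.logb 2 (gbar W A a) + n * ((Real.negMulLog δ + Fintype.card Y * δ) / Real.log 2) := by
    rw [← hBcard]
    have hrhs : Real.logb 2 (B.card * Real.exp (n * (Real.negMulLog δ + Fintype.card Y * δ))) =
        Real.logb 2 B.card + n * ((Real.negMulLog δ + Fintype.card Y * δ) / Real.log 2) := by
      rw [Real.logb_mul hBpos.ne' (Real.exp_pos _).ne', Real.logb, Real.logb, Real.log_exp]
      ring
    rcases Nat.eq_zero_or_pos (gimg W A' (1 - 1 / (n : ℝ))) with h0 | h0
    · rw [h0, Nat.cast_zero, Real.logb_zero]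
      have : 0 ≤ Real.logb 2 (B.card : ℝ) :=
        Real.logb_nonneg one_lt_two (by exact_mod_cast hBne.card_pos)
      positivity
    · rw [← hrhs]
      refine Real.logb_le_logb_of_le one_lt_two (by exact_mod_cast h0) ?_
      exact le_trans (by exact_mod_cast himg) (card_hammingBlowUp_le B hδ hδ1)
  calc _ ≤ 1 / (n : ℝ) * (Real.logb 2 (gbar W A a) +
        n * ((Real.negMulLog δ + Fintype.card Y * δ) / Real.log 2)) := by gcongr
    _ = _ := by field_simp

/-- The blow-up parameters can be chosen from any sublinear bound `L n` on
`log (n ^ 2 / α n)`. -/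
lemma exists_image_rate {W : X → Y → ℝ} (hW : isChannel W) (L : ℕ → ℝ)
    (hL : Tendsto (fun n : ℕ => L n / n) atTop (nhds 0)) :
    ∃ τ β : ℕ → ℝ, (∀ n, 0 ≤ τ n) ∧ Tendsto τ atTop (nhds 0) ∧
      (∀ n, β n ∈ Set.Ioo (0 : ℝ) 1) ∧ Tendsto β atTop (nhds 1) ∧
      ∀ α : ℕ → ℝ, (∀ n, α n ∈ Set.Ioc (0 : ℝ) 1) →
        (∀ n : ℕ, 1 ≤ n → 2 * Real.log n - Real.log (α n) ≤ L n) →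
        ∃ N : ℕ, ∀ n : ℕ, N ≤ n → ∀ A : Finset (Fin n → X), A.Nonempty →
          ∃ A' : Finset (Fin n → X), A' ⊆ A ∧ A'.Nonempty ∧
            (1 - 1 / (n : ℝ)) * α n ≤ (A'.card : ℝ) / (A.card : ℝ) ∧
            (1 / (n : ℝ)) * Real.logb 2 (gimg W A' (β n)) ≤
              (1 / (n : ℝ)) * Real.logb 2 (gbar W A (α n)) + τ n := by
  set δ : ℕ → ℝ := fun n => √(2 * (L n / n)) with hδdef
  have hδ : Tendsto δ atTop (nhds 0) := by
    have h := (hL.const_mul 2).sqrt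
    rwa [mul_zero, Real.sqrt_zero] at h
  have hinv : Tendsto (fun n : ℕ => 1 / (n : ℝ)) atTop (nhds 0) := tendsto_one_div_atTop_nhds_zero_nat
  refine ⟨fun n => |(Real.negMulLog (δ n) + Fintype.card Y * δ n) / Real.log 2|,
    fun n => if 2 ≤ n then 1 - 1 / (n : ℝ) else 1 / 2, fun n => abs_nonneg _, ?_, ?_, ?_, ?_⟩
  · have h1 := (Real.continuous_negMulLog.tendsto 0).comp hδ
    have h2 := ((h1.add (hδ.const_mul (Fintype.card Y : ℝ))).div_const (Real.log 2)).abs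
    simpa [Function.comp_def] using h2
  · intro n
    dsimp only
    split_ifs with hn
    · have hn2 : (2 : ℝ) ≤ n := by exact_mod_cast hn
      have h1 : 1 / (n : ℝ) < 1 := by rw [div_lt_one (by linarith)]; linarith
      have h2 : 0 < 1 / (n : ℝ) := by positivity
      constructor <;> linarith
    · constructor <;> norm_num
  · have h1 : Tendsto (fun n : ℕ => 1 - 1 / (n : ℝ)) atTop (nhds 1) := by
      simpa using hinv.const_sub 1
    refine h1.congr' ?_
    filter_upwards [eventually_ge_atTop 2] with n hn
    rw [if_pos hn]
  · intro α hα hαL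
    have hev : ∀ᶠ n : ℕ in atTop, δ n ≤ 1 := hδ.eventually_le_const one_pos
    obtain ⟨N, hN⟩ := eventually_atTop.1 (hev.and (eventually_ge_atTop 2))
    refine ⟨N, fun n hn A hA => ?_⟩
    obtain ⟨hδ1, hn2⟩ := hN n hn
    have hn2' : (2 : ℝ) ≤ n := by exact_mod_cast hn2
    have hn0 : (0 : ℝ) < n := by linarith
    have hLn := hαL n (by omega)
    have hLpos : 0 < L n := by
      have h1 : 0 < Real.log n := Real.log_pos (by linarith)
      have h2 : Real.log (α n) ≤ 0 := Real.log_nonpos (hα n).1.le (hα n).2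
      linarith
    have hq : 0 < 2 * (L n / n) := by positivity
    have hδa : 2 * Real.log n - Real.log (α n) ≤ n * δ n ^ 2 / 2 := by
      rw [hδdef]
      dsimp only
      rw [Real.sq_sqrt hq.le]
      refine hLn.trans (le_of_eq ?_)
      field_simp
    obtain ⟨A', h1, h2, h3, h4⟩ := exists_subset_logb_gimg_le hW hn2 hA (hα n).1 (hα n).2
      (Real.sqrt_pos.2 hq) hδ1 hδa
    refine ⟨A', h1, h2, h3, ?_⟩
    simp only [if_pos hn2]
    exact h4.trans (add_le_add le_rfl (le_abs_self _))

end Images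

open Filter in
/-- Lemma 4: given `α_n ∈ (0,1]` with `(-log₂ α_n)/n → 0`, there are
`τ_n → 0` and `β_n → 1` such that eventually every nonempty `A` contains a nonempty `A'`
with `|A'|/|A| ≥ (1 - 1/n) α_n` and
`(1/n) log₂ gⁿ(A',β_n) ≤ (1/n) log₂ ḡⁿ(A,α_n) + τ_n`.  Moreover, if `α_n ≥ 1/n` then
`β_n` and `τ_n` can be chosen independently of the sequence `(α_n)`. -/
theorem stmt_6 {X Y : Type*} [Fintype X] [Fintype Y] [Nonempty X] [Nonempty Y]
    (W : X → Y → ℝ) (hW : isChannel W) :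
    (∀ α : ℕ → ℝ, (∀ n, α n ∈ Set.Ioc (0:ℝ) 1) →
      Tendsto (fun n : ℕ => -Real.logb 2 (α n) / (n:ℝ)) atTop (nhds 0) →
      ∃ τ β : ℕ → ℝ,
        (∀ n, 0 ≤ τ n) ∧ Tendsto τ atTop (nhds 0) ∧
        (∀ n, β n ∈ Set.Ioo (0:ℝ) 1) ∧ Tendsto β atTop (nhds 1) ∧
        ∃ N : ℕ, ∀ n : ℕ, N ≤ n → ∀ A : Finset (Fin n → X), A.Nonempty →
          ∃ A' : Finset (Fin n → X), A' ⊆ A ∧ A'.Nonempty ∧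
            (1 - 1 / (n:ℝ)) * α n ≤ (A'.card : ℝ) / (A.card : ℝ) ∧
            (1 / (n:ℝ)) * Real.logb 2 (gimg W A' (β n)) ≤
              (1 / (n:ℝ)) * Real.logb 2 (gbar W A (α n)) + τ n) ∧
    (∃ τ β : ℕ → ℝ,
      (∀ n, 0 ≤ τ n) ∧ Tendsto τ atTop (nhds 0) ∧
      (∀ n, β n ∈ Set.Ioo (0:ℝ) 1) ∧ Tendsto β atTop (nhds 1) ∧
      ∀ α : ℕ → ℝ, (∀ n, α n ∈ Set.Ioc (0:ℝ) 1) → (∀ n : ℕ, 1 ≤ n → 1 / (n:ℝ) ≤ α n) →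
        ∃ N : ℕ, ∀ n : ℕ, N ≤ n → ∀ A : Finset (Fin n → X), A.Nonempty →
          ∃ A' : Finset (Fin n → X), A' ⊆ A ∧ A'.Nonempty ∧
            (1 - 1 / (n:ℝ)) * α n ≤ (A'.card : ℝ) / (A.card : ℝ) ∧
            (1 / (n:ℝ)) * Real.logb 2 (gimg W A' (β n)) ≤
              (1 / (n:ℝ)) * Real.logb 2 (gbar W A (α n)) + τ n) := by
  have hlog : Tendsto (fun n : ℕ => Real.log n / (n : ℝ)) atTop (nhds 0) :=
    (Real.isLittleO_log_id_atTop.tendsto_div_nhds_zero).comp tendsto_natCast_atTop_atTop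
  refine ⟨fun α hα hlim => ?_, ?_⟩
  · have hL : Tendsto (fun n : ℕ => (2 * Real.log n - Real.log (α n)) / n) atTop (nhds 0) := by
      have h := (hlog.const_mul 2).add (hlim.const_mul (Real.log 2))
      simp only [mul_zero, add_zero] at h
      refine h.congr fun n => ?_
      have h2 : Real.log 2 * Real.logb 2 (α n) = Real.log (α n) :=
        mul_div_cancel₀ _ (Real.log_pos one_lt_two).ne'
      rw [← h2]
      ring
    obtain ⟨τ, β, h1, h2, h3, h4, h5⟩ := exists_image_rate (X := X) hW _ hL
    exact ⟨τ, β, h1, h2, h3, h4, h5 α hα fun n _ => le_rfl⟩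
  · have hL : Tendsto (fun n : ℕ => 3 * Real.log n / n) atTop (nhds 0) := by
      simpa [mul_div_assoc] using hlog.const_mul 3
    obtain ⟨τ, β, h1, h2, h3, h4, h5⟩ := exists_image_rate (X := X) hW _ hL
    refine ⟨τ, β, h1, h2, h3, h4, fun α hα hαn => h5 α hα fun n hn => ?_⟩
    have hn0 : (0 : ℝ) < n := by exact_mod_cast hn
    have h6 := Real.log_le_log (by positivity) (hαn n hn)
    rw [one_div, Real.log_inv] at h6
    linarith
end
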